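/- Let (E, A) be a concrete Hilbert locally C*-module with respect to locally Hilbert spaces H = ⋃_{λ∈Λ} H_λ and K = ⋃_{λ∈Λ} K_λ over Λ, and let (F, B) be a concrete Hilbert locally C*-module with respect to locally Hilbert spaces G = ⋃_{α∈A'} G_α and N = ⋃_{α∈A'} N_α over A'. Let C be the closure, in the seminorm topology of B_loc(H ⊗_loc G), of the linear span of {a ⊗_loc b : a ∈ A, b ∈ B}, and let Ê be the closure, in the seminorm topology of B_loc(H ⊗_loc G, K ⊗_loc N), of the linear span of {T ⊗_loc S : T ∈ E, S ∈ F}. Then: (i) (T₁ ⊗_loc S₁)* ∘ (T₂ ⊗_loc S₂) = (T₁* ∘ T₂) ⊗_loc (S₁* ∘ S₂) for all T₁, T₂ ∈ E and S₁, S₂ ∈ F; (ii) C is a *-subalgebra of B_loc(H ⊗_loc G); (iii) Ê ∘ C ⊆ Ê and T* ∘ S ∈ C for all T, S ∈ Ê. Consequently (Ê, C) is a concrete Hilbert locally C*-module, the exterior tensor product of E and F. -/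

import Mathlib

open scoped InnerProductSpace ComplexOrder

noncomputable section

universe u v w

/-- A locally Hilbert space structure over the directed poset `Λ` on the
inner product space `H`: a monotone family of complete subspaces whose union is `H`. -/
structure LocallyHilbert (Λ : Type v) [PartialOrder Λ] (H : Type u)
    [NormedAddCommGroup H] [InnerProductSpace ℂ H] : Type (max u v) where
  E : Λ → Submodule ℂ H
  mono : Monotone E
  isComplete : ∀ lam : Λ, IsComplete (E lam : Set H)
  exhaustive : ∀ h : H, ∃ lam : Λ, h ∈ E lam

/-- A bundled locally Hilbert space over `Λ`. -/
structure LocHilbertBundle (Λ : Type v) [PartialOrder Λ] : Type (max (u + 1) v) where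
  carrier : Type u
  [ngroup : NormedAddCommGroup carrier]
  [ips : InnerProductSpace ℂ carrier]
  str : LocallyHilbert Λ carrier

attribute [instance] LocHilbertBundle.ngroup LocHilbertBundle.ips

variable {Λ : Type v} [PartialOrder Λ]
variable {H : Type u} [NormedAddCommGroup H] [InnerProductSpace ℂ H]
variable {K : Type w} [NormedAddCommGroup K] [InnerProductSpace ℂ K]

/-- `T : H → K` is a locally bounded operator: it maps each `H_λ` into `K_λ`, boundedly,
and (equivalently to the usual formulation) the adjoints of its restrictions are
compatible, i.e. for every `k ∈ K_λ` the functional `h ↦ ⟪T h, k⟫` is represented by a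
vector of `H_λ`. -/
structure IsLocallyBounded (hH : LocallyHilbert Λ H) (hK : LocallyHilbert Λ K)
    (T : H →ₗ[ℂ] K) : Prop where
  maps_mem : ∀ lam : Λ, ∀ h ∈ hH.E lam, T h ∈ hK.E lam
  bound : ∀ lam : Λ, ∃ C : ℝ, ∀ h ∈ hH.E lam, ‖T h‖ ≤ C * ‖h‖
  adjoint_mem : ∀ lam : Λ, ∀ k ∈ hK.E lam, ∃ v ∈ hH.E lam,
    ∀ h : H, ⟪T h, k⟫_ℂ = ⟪h, v⟫_ℂ

/-- `S` is the (formal) adjoint of `T`. -/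
def IsLAdjoint (T : H →ₗ[ℂ] K) (S : K →ₗ[ℂ] H) : Prop :=
  ∀ (h : H) (k : K), ⟪T h, k⟫_ℂ = ⟪h, S k⟫_ℂ

/-- The operator norm of the restriction of `T` to the submodule `p`. -/
def restNorm (p : Submodule ℂ H) (T : H →ₗ[ℂ] K) : ℝ :=
  sInf {C : ℝ | 0 ≤ C ∧ ∀ h ∈ p, ‖T h‖ ≤ C * ‖h‖}

/-- Positive semidefiniteness of a kernel with values locally bounded operators. -/
def IsPSDKernel {X : Type*} (k : X → X → (H →ₗ[ℂ] H)) : Prop :=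
  ∀ (n : ℕ) (x : Fin n → X) (h : Fin n → H),
    0 ≤ ∑ i, ∑ j, ⟪h i, k (x i) (x j) (h j)⟫_ℂ


universe u₁ u₂ u₃ u₄ u₅ u₆ v₁ v₂

/-- `(P, t)` realises the locally Hilbert space tensor product `H ⊗_loc G`. -/
structure IsLocTensor {Λ : Type v₁} [PartialOrder Λ] {A' : Type v₂} [PartialOrder A']
    {H : Type u₁} [NormedAddCommGroup H] [InnerProductSpace ℂ H]
    {G : Type u₂} [NormedAddCommGroup G] [InnerProductSpace ℂ G]
    {P : Type u₃} [NormedAddCommGroup P] [InnerProductSpace ℂ P]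
    (hH : LocallyHilbert Λ H) (hG : LocallyHilbert A' G)
    (hP : LocallyHilbert (Λ × A') P) (t : H →ₗ[ℂ] G →ₗ[ℂ] P) : Prop where
  inner_eq : ∀ (h h' : H) (g g' : G), ⟪t h g, t h' g'⟫_ℂ = ⟪h, h'⟫_ℂ * ⟪g, g'⟫_ℂ
  dense_span : ∀ (lam : Λ) (α : A'),
    (Submodule.span ℂ {u : P | ∃ h ∈ hH.E lam, ∃ g ∈ hG.E α, t h g = u}).topologicalClosure
      = hP.E (lam, α)

/-- `U` acts as `T ⊗ S` on elementary tensors. -/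
def IsTensorOp {H G P K N Q : Type*}
    [AddCommGroup H] [Module ℂ H] [AddCommGroup G] [Module ℂ G]
    [AddCommGroup P] [Module ℂ P] [AddCommGroup K] [Module ℂ K]
    [AddCommGroup N] [Module ℂ N] [AddCommGroup Q] [Module ℂ Q]
    (t : H →ₗ[ℂ] G →ₗ[ℂ] P) (t' : K →ₗ[ℂ] N →ₗ[ℂ] Q)
    (T : H →ₗ[ℂ] K) (S : G →ₗ[ℂ] N) (U : P →ₗ[ℂ] Q) : Prop :=
  ∀ (h : H) (g : G), U (t h g) = t' (T h) (S g)

/-- A concrete Hilbert locally C*-module `(E, A)`: `A ⊆ B_loc(H)` is a `*`-subalgebra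
closed in the seminorm topology and `E ⊆ B_loc(H,K)` is a closed linear subspace with
`E ∘ A ⊆ E` and `T* ∘ S ∈ A` for `T, S ∈ E`. -/
structure IsConcreteModule {Λ : Type*} [PartialOrder Λ]
    {H : Type*} [NormedAddCommGroup H] [InnerProductSpace ℂ H]
    {K : Type*} [NormedAddCommGroup K] [InnerProductSpace ℂ K]
    (hH : LocallyHilbert Λ H) (hK : LocallyHilbert Λ K)
    (Aset : Set (H →ₗ[ℂ] H)) (Eset : Set (H →ₗ[ℂ] K)) : Prop where
  alg_lb : ∀ a ∈ Aset, IsLocallyBounded hH hH a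
  alg_add : ∀ a ∈ Aset, ∀ b ∈ Aset, a + b ∈ Aset
  alg_smul : ∀ (c : ℂ), ∀ a ∈ Aset, c • a ∈ Aset
  alg_mul : ∀ a ∈ Aset, ∀ b ∈ Aset, a ∘ₗ b ∈ Aset
  alg_star : ∀ a ∈ Aset, ∀ b : _ →ₗ[ℂ] _, IsLAdjoint a b → b ∈ Aset
  alg_closed : ∀ T : _ →ₗ[ℂ] _, IsLocallyBounded hH hH T →
    (∀ (lam : Λ) (ε : ℝ), 0 < ε → ∃ U ∈ Aset, restNorm (hH.E lam) (T - U) < ε) → T ∈ Aset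
  mod_lb : ∀ T ∈ Eset, IsLocallyBounded hH hK T
  mod_add : ∀ T ∈ Eset, ∀ S ∈ Eset, T + S ∈ Eset
  mod_smul : ∀ (c : ℂ), ∀ T ∈ Eset, c • T ∈ Eset
  mod_closed : ∀ T : _ →ₗ[ℂ] _, IsLocallyBounded hH hK T →
    (∀ (lam : Λ) (ε : ℝ), 0 < ε → ∃ U ∈ Eset, restNorm (hH.E lam) (T - U) < ε) → T ∈ Eset
  mod_smulA : ∀ T ∈ Eset, ∀ a ∈ Aset, T ∘ₗ a ∈ Eset
  mod_gram : ∀ T ∈ Eset, ∀ S ∈ Eset, ∀ Tstar : _ →ₗ[ℂ] _,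
    IsLAdjoint T Tstar → Tstar ∘ₗ S ∈ Aset

/-- The closure, inside `B_loc(P,Q)` with its seminorm topology, of the linear span of
a set `M` of operators. -/
def locClosedSpan {Γ : Type*} [PartialOrder Γ]
    {P : Type*} [NormedAddCommGroup P] [InnerProductSpace ℂ P]
    {Q : Type*} [NormedAddCommGroup Q] [InnerProductSpace ℂ Q]
    (hP : LocallyHilbert Γ P) (hQ : LocallyHilbert Γ Q)
    (M : Set (P →ₗ[ℂ] Q)) : Set (P →ₗ[ℂ] Q) :=
  {U | IsLocallyBounded hP hQ U ∧ ∀ (γ : Γ) (ε : ℝ), 0 < ε →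
    ∃ V ∈ Submodule.span ℂ M, restNorm (hP.E γ) (U - V) < ε}

section LocallyBoundedOperators

variable {Γ : Type*} [PartialOrder Γ]
  {P : Type*} [NormedAddCommGroup P] [InnerProductSpace ℂ P]
  {Q : Type*} [NormedAddCommGroup Q] [InnerProductSpace ℂ Q]
  {R : Type*} [NormedAddCommGroup R] [InnerProductSpace ℂ R]
  {hP : LocallyHilbert Γ P} {hQ : LocallyHilbert Γ Q} {hR : LocallyHilbert Γ R}

theorem restNorm_le_of_bound {p : Submodule ℂ P} {T : P →ₗ[ℂ] Q} {C : ℝ} (hC : 0 ≤ C)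
    (h : ∀ x ∈ p, ‖T x‖ ≤ C * ‖x‖) : restNorm p T ≤ C :=
  csInf_le ⟨0, fun _ hc => hc.1⟩ ⟨hC, h⟩

theorem IsLocallyBounded.exists_nonneg_bound {T : P →ₗ[ℂ] Q} (hT : IsLocallyBounded hP hQ T)
    (γ : Γ) : ∃ C : ℝ, 0 ≤ C ∧ ∀ x ∈ hP.E γ, ‖T x‖ ≤ C * ‖x‖ := by
  obtain ⟨C, hC⟩ := hT.bound γ
  exact ⟨max C 0, le_max_right _ _, fun x hx => (hC x hx).trans
    (mul_le_mul_of_nonneg_right (le_max_left _ _) (norm_nonneg x))⟩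

theorem IsLocallyBounded.bound_of_restNorm_lt {T : P →ₗ[ℂ] Q} (hT : IsLocallyBounded hP hQ T)
    {γ : Γ} {ε : ℝ} (h : restNorm (hP.E γ) T < ε) : ∀ x ∈ hP.E γ, ‖T x‖ ≤ ε * ‖x‖ := by
  obtain ⟨C, hC, hlt⟩ := exists_lt_of_csInf_lt (hT.exists_nonneg_bound γ) h
  exact fun x hx => (hC.2 x hx).trans (mul_le_mul_of_nonneg_right hlt.le (norm_nonneg x))

variable (hP hQ) in
/-- The space of locally bounded operators, as a subspace of all linear maps. -/
def locallyBounded : Submodule ℂ (P →ₗ[ℂ] Q) where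
  carrier := {T | IsLocallyBounded hP hQ T}
  zero_mem' := ⟨fun γ _ _ => (hQ.E γ).zero_mem, fun _ => ⟨0, by simp⟩,
    fun γ _ _ => ⟨0, (hP.E γ).zero_mem, by simp⟩⟩
  add_mem' := by
    intro S T hS hT
    refine ⟨fun γ x hx => (hQ.E γ).add_mem (hS.maps_mem γ x hx) (hT.maps_mem γ x hx),
      fun γ => ?_, fun γ y hy => ?_⟩
    · obtain ⟨C, hC⟩ := hS.bound γ
      obtain ⟨D, hD⟩ := hT.bound γ
      refine ⟨C + D, fun x hx => ?_⟩
      calc ‖(S + T) x‖ ≤ ‖S x‖ + ‖T x‖ := norm_add_le _ _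
        _ ≤ (C + D) * ‖x‖ := by linarith [hC x hx, hD x hx]
    · obtain ⟨v, hv, hv'⟩ := hS.adjoint_mem γ y hy
      obtain ⟨w, hw, hw'⟩ := hT.adjoint_mem γ y hy
      refine ⟨v + w, (hP.E γ).add_mem hv hw, fun x => ?_⟩
      rw [LinearMap.add_apply, inner_add_left, inner_add_right, hv', hw']
  smul_mem' := by
    intro c T hT
    refine ⟨fun γ x hx => (hQ.E γ).smul_mem c (hT.maps_mem γ x hx), fun γ => ?_,
      fun γ y hy => ?_⟩
    · obtain ⟨C, hC⟩ := hT.bound γ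
      refine ⟨‖c‖ * C, fun x hx => ?_⟩
      rw [LinearMap.smul_apply, norm_smul, mul_assoc]
      exact mul_le_mul_of_nonneg_left (hC x hx) (norm_nonneg c)
    · obtain ⟨v, hv, hv'⟩ := hT.adjoint_mem γ y hy
      refine ⟨(starRingEnd ℂ) c • v, (hP.E γ).smul_mem _ hv, fun x => ?_⟩
      rw [LinearMap.smul_apply, inner_smul_left, inner_smul_right, hv']

theorem IsLocallyBounded.comp {S : Q →ₗ[ℂ] R} {T : P →ₗ[ℂ] Q} (hS : IsLocallyBounded hQ hR S)
    (hT : IsLocallyBounded hP hQ T) : IsLocallyBounded hP hR (S ∘ₗ T) := by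
  refine ⟨fun γ x hx => hS.maps_mem γ _ (hT.maps_mem γ x hx), fun γ => ?_, fun γ z hz => ?_⟩
  · obtain ⟨C, hC0, hC⟩ := hS.exists_nonneg_bound γ
    obtain ⟨D, hD⟩ := hT.bound γ
    refine ⟨C * D, fun x hx => (hC _ (hT.maps_mem γ x hx)).trans ?_⟩
    rw [mul_assoc]
    exact mul_le_mul_of_nonneg_left (hD x hx) hC0
  · obtain ⟨y, hy, hy'⟩ := hS.adjoint_mem γ z hz
    obtain ⟨x, hx, hx'⟩ := hT.adjoint_mem γ y hy
    exact ⟨x, hx, fun u => by rw [LinearMap.comp_apply, hy', hx']⟩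

theorem IsLAdjoint.symm {T : P →ₗ[ℂ] Q} {S : Q →ₗ[ℂ] P} (h : IsLAdjoint T S) :
    IsLAdjoint S T := fun y x => by
  rw [← inner_conj_symm, ← h, inner_conj_symm]

theorem IsLocallyBounded.exists_isLAdjoint {T : P →ₗ[ℂ] Q} (hT : IsLocallyBounded hP hQ T) :
    ∃ S : Q →ₗ[ℂ] P, IsLAdjoint T S := by
  have hex (y : Q) : ∃ v : P, ∀ x, ⟪T x, y⟫_ℂ = ⟪x, v⟫_ℂ := by
    obtain ⟨γ, hγ⟩ := hQ.exhaustive y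
    obtain ⟨v, -, hv⟩ := hT.adjoint_mem γ y hγ
    exact ⟨v, hv⟩
  choose f hf using hex
  refine ⟨{ toFun := f, map_add' := fun y z => ?_, map_smul' := fun c y => ?_ },
    fun x y => hf y x⟩
  · exact ext_inner_left ℂ fun x => by rw [inner_add_right, ← hf, ← hf, ← hf, inner_add_right]
  · exact ext_inner_left ℂ fun x => by
      rw [RingHom.id_apply, inner_smul_right, ← hf, ← hf, inner_smul_right]

theorem IsLocallyBounded.adjoint_maps_mem {T : P →ₗ[ℂ] Q} (hT : IsLocallyBounded hP hQ T)
    {S : Q →ₗ[ℂ] P} (h : IsLAdjoint T S) {γ : Γ} {y : Q} (hy : y ∈ hQ.E γ) :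
    S y ∈ hP.E γ := by
  obtain ⟨v, hv, hv'⟩ := hT.adjoint_mem γ y hy
  have : S y = v := ext_inner_left ℂ fun x => by rw [← h, hv']
  exact this ▸ hv

theorem IsLocallyBounded.adjoint_bound {T : P →ₗ[ℂ] Q} (hT : IsLocallyBounded hP hQ T)
    {S : Q →ₗ[ℂ] P} (h : IsLAdjoint T S) {γ : Γ} {C : ℝ} (hC0 : 0 ≤ C)
    (hC : ∀ x ∈ hP.E γ, ‖T x‖ ≤ C * ‖x‖) : ∀ y ∈ hQ.E γ, ‖S y‖ ≤ C * ‖y‖ := by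
  intro y hy
  rcases (norm_nonneg (S y)).eq_or_lt with h0 | hpos
  · rw [← h0]; positivity
  refine le_of_mul_le_mul_left ?_ hpos
  calc ‖S y‖ * ‖S y‖ = ‖⟪S y, S y⟫_ℂ‖ := by
        rw [inner_self_eq_norm_sq_to_K]; simp [sq]
    _ = ‖⟪T (S y), y⟫_ℂ‖ := by rw [h]
    _ ≤ ‖T (S y)‖ * ‖y‖ := norm_inner_le_norm _ _
    _ ≤ C * ‖S y‖ * ‖y‖ :=
        mul_le_mul_of_nonneg_right (hC _ (hT.adjoint_maps_mem h hy)) (norm_nonneg y)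
    _ = ‖S y‖ * (C * ‖y‖) := by ring

theorem IsLocallyBounded.adjoint {T : P →ₗ[ℂ] Q} (hT : IsLocallyBounded hP hQ T)
    {S : Q →ₗ[ℂ] P} (h : IsLAdjoint T S) : IsLocallyBounded hQ hP S := by
  refine ⟨fun γ y hy => hT.adjoint_maps_mem h hy, fun γ => ?_,
    fun γ x hx => ⟨T x, hT.maps_mem γ x hx, fun y => h.symm y x⟩⟩
  obtain ⟨C, hC0, hC⟩ := hT.exists_nonneg_bound γ
  exact ⟨C, hT.adjoint_bound h hC0 hC⟩

theorem mem_locClosedSpan_iff {M : Set (P →ₗ[ℂ] Q)} (hM : M ⊆ locallyBounded hP hQ)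
    {U : P →ₗ[ℂ] Q} :
    U ∈ locClosedSpan hP hQ M ↔ IsLocallyBounded hP hQ U ∧ ∀ (γ : Γ) (ε : ℝ), 0 < ε →
      ∃ V ∈ Submodule.span ℂ M, ∀ x ∈ hP.E γ, ‖(U - V) x‖ ≤ ε * ‖x‖ := by
  refine and_congr_right fun hU => forall_congr' fun γ => ⟨fun h ε hε => ?_, fun h ε hε => ?_⟩
  · obtain ⟨V, hV, hlt⟩ := h ε hε
    exact ⟨V, hV, IsLocallyBounded.bound_of_restNorm_lt (hQ := hQ)
      ((locallyBounded hP hQ).sub_mem hU (Submodule.span_le.2 hM hV)) hlt⟩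
  · obtain ⟨V, hV, hle⟩ := h (ε / 2) (half_pos hε)
    exact ⟨V, hV, (restNorm_le_of_bound (half_pos hε).le hle).trans_lt (half_lt_self hε)⟩

theorem add_mem_locClosedSpan {M : Set (P →ₗ[ℂ] Q)} (hM : M ⊆ locallyBounded hP hQ)
    {S T : P →ₗ[ℂ] Q} (hS : S ∈ locClosedSpan hP hQ M) (hT : T ∈ locClosedSpan hP hQ M) :
    S + T ∈ locClosedSpan hP hQ M := by
  rw [mem_locClosedSpan_iff hM] at *
  refine ⟨(locallyBounded hP hQ).add_mem hS.1 hT.1, fun γ ε hε => ?_⟩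
  obtain ⟨V, hV, hV'⟩ := hS.2 γ (ε / 2) (half_pos hε)
  obtain ⟨W, hW, hW'⟩ := hT.2 γ (ε / 2) (half_pos hε)
  refine ⟨V + W, Submodule.add_mem _ hV hW, fun x hx => ?_⟩
  calc ‖(S + T - (V + W)) x‖ = ‖(S - V) x + (T - W) x‖ := by
        rw [add_sub_add_comm, LinearMap.add_apply]
    _ ≤ ‖(S - V) x‖ + ‖(T - W) x‖ := norm_add_le _ _
    _ ≤ ε * ‖x‖ := by linarith [hV' x hx, hW' x hx]

theorem smul_mem_locClosedSpan {M : Set (P →ₗ[ℂ] Q)} (hM : M ⊆ locallyBounded hP hQ)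
    (c : ℂ) {T : P →ₗ[ℂ] Q} (hT : T ∈ locClosedSpan hP hQ M) :
    c • T ∈ locClosedSpan hP hQ M := by
  rw [mem_locClosedSpan_iff hM] at *
  refine ⟨(locallyBounded hP hQ).smul_mem c hT.1, fun γ ε hε => ?_⟩
  obtain ⟨V, hV, hV'⟩ := hT.2 γ (ε / (‖c‖ + 1)) (by positivity)
  refine ⟨c • V, Submodule.smul_mem _ c hV, fun x hx => ?_⟩
  rw [← smul_sub, LinearMap.smul_apply, norm_smul]
  calc ‖c‖ * ‖(T - V) x‖ ≤ (‖c‖ + 1) * (ε / (‖c‖ + 1) * ‖x‖) :=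
        mul_le_mul (by linarith) (hV' x hx) (norm_nonneg _) (by positivity)
    _ = ε * ‖x‖ := by field_simp

theorem mem_locClosedSpan_of_forall_exists {M : Set (P →ₗ[ℂ] Q)}
    (hM : M ⊆ locallyBounded hP hQ) {T : P →ₗ[ℂ] Q} (hT : IsLocallyBounded hP hQ T)
    (h : ∀ (γ : Γ) (ε : ℝ), 0 < ε →
      ∃ U ∈ locClosedSpan hP hQ M, restNorm (hP.E γ) (T - U) < ε) :
    T ∈ locClosedSpan hP hQ M := by
  rw [mem_locClosedSpan_iff hM]
  refine ⟨hT, fun γ ε hε => ?_⟩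
  obtain ⟨U, hU, hTU⟩ := h γ (ε / 2) (half_pos hε)
  rw [mem_locClosedSpan_iff hM] at hU
  have hTU' := IsLocallyBounded.bound_of_restNorm_lt (hQ := hQ)
    ((locallyBounded hP hQ).sub_mem hT hU.1) hTU
  obtain ⟨V, hV, hUV⟩ := hU.2 γ (ε / 2) (half_pos hε)
  refine ⟨V, hV, fun x hx => ?_⟩
  calc ‖(T - V) x‖ = ‖(T - U) x + (U - V) x‖ := by
        rw [← LinearMap.add_apply, sub_add_sub_cancel]
    _ ≤ ‖(T - U) x‖ + ‖(U - V) x‖ := norm_add_le _ _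
    _ ≤ ε * ‖x‖ := by linarith [hTU' x hx, hUV x hx]

theorem comp_mem_span {M₁ : Set (Q →ₗ[ℂ] R)} {M₂ : Set (P →ₗ[ℂ] Q)} {M₃ : Set (P →ₗ[ℂ] R)}
    (h : ∀ U ∈ M₁, ∀ V ∈ M₂, U ∘ₗ V ∈ M₃) {U : Q →ₗ[ℂ] R} {V : P →ₗ[ℂ] Q}
    (hU : U ∈ Submodule.span ℂ M₁) (hV : V ∈ Submodule.span ℂ M₂) :
    U ∘ₗ V ∈ Submodule.span ℂ M₃ := by
  induction hU, hV using Submodule.span_induction₂ with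
  | mem_mem U V hU hV => exact Submodule.subset_span (h U hU V hV)
  | zero_left V hV => simp
  | zero_right U hU => simp
  | add_left U U' V _ _ _ h₁ h₂ => rw [LinearMap.add_comp]; exact add_mem h₁ h₂
  | add_right U V V' _ _ _ h₁ h₂ => rw [LinearMap.comp_add]; exact add_mem h₁ h₂
  | smul_left c U V _ _ h₁ => rw [LinearMap.smul_comp]; exact Submodule.smul_mem _ c h₁
  | smul_right c U V _ _ h₁ => rw [LinearMap.comp_smul]; exact Submodule.smul_mem _ c h₁

theorem comp_mem_locClosedSpan {M₁ : Set (Q →ₗ[ℂ] R)} {M₂ : Set (P →ₗ[ℂ] Q)}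
    {M₃ : Set (P →ₗ[ℂ] R)} (hM₁ : M₁ ⊆ locallyBounded hQ hR) (hM₂ : M₂ ⊆ locallyBounded hP hQ)
    (hM₃ : M₃ ⊆ locallyBounded hP hR) (h : ∀ U ∈ M₁, ∀ V ∈ M₂, U ∘ₗ V ∈ M₃)
    {S : Q →ₗ[ℂ] R} {T : P →ₗ[ℂ] Q} (hS : S ∈ locClosedSpan hQ hR M₁)
    (hT : T ∈ locClosedSpan hP hQ M₂) : S ∘ₗ T ∈ locClosedSpan hP hR M₃ := by
  rw [mem_locClosedSpan_iff hM₁] at hS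
  rw [mem_locClosedSpan_iff hM₂] at hT
  rw [mem_locClosedSpan_iff hM₃]
  refine ⟨hS.1.comp hT.1, fun γ ε hε => ?_⟩
  obtain ⟨C, hC0, hC⟩ := hT.1.exists_nonneg_bound γ
  obtain ⟨U, hU, hSU⟩ := hS.2 γ (ε / 2 / (C + 1)) (by positivity)
  have hU' : IsLocallyBounded hQ hR U := Submodule.span_le.2 hM₁ hU
  obtain ⟨D, hD0, hD⟩ := hU'.exists_nonneg_bound γ
  obtain ⟨V, hV, hTV⟩ := hT.2 γ (ε / 2 / (D + 1)) (by positivity)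
  have hV' : IsLocallyBounded hP hQ V := Submodule.span_le.2 hM₂ hV
  have hmem := ((locallyBounded hP hQ).sub_mem hT.1 hV').maps_mem γ
  refine ⟨U ∘ₗ V, comp_mem_span h hU hV, fun x hx => ?_⟩
  have h₁ : ‖(S - U) (T x)‖ ≤ ε / 2 * ‖x‖ :=
    calc ‖(S - U) (T x)‖ ≤ ε / 2 / (C + 1) * ‖T x‖ := hSU _ (hT.1.maps_mem γ x hx)
      _ ≤ ε / 2 / (C + 1) * ((C + 1) * ‖x‖) := by
        refine mul_le_mul_of_nonneg_left ((hC x hx).trans ?_) (by positivity)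
        exact mul_le_mul_of_nonneg_right (by linarith) (norm_nonneg x)
      _ = ε / 2 * ‖x‖ := by field_simp
  have h₂ : ‖U ((T - V) x)‖ ≤ ε / 2 * ‖x‖ :=
    calc ‖U ((T - V) x)‖ ≤ D * ‖(T - V) x‖ := hD _ (hmem x hx)
      _ ≤ (D + 1) * (ε / 2 / (D + 1) * ‖x‖) :=
        mul_le_mul (by linarith) (hTV x hx) (norm_nonneg _) (by positivity)
      _ = ε / 2 * ‖x‖ := by field_simp
  calc ‖(S ∘ₗ T - U ∘ₗ V) x‖ = ‖(S - U) (T x) + U ((T - V) x)‖ := by simp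
    _ ≤ ‖(S - U) (T x)‖ + ‖U ((T - V) x)‖ := norm_add_le _ _
    _ ≤ ε * ‖x‖ := by linarith

theorem exists_isLAdjoint_mem_span {M : Set (P →ₗ[ℂ] Q)} {M' : Set (Q →ₗ[ℂ] P)}
    (h : ∀ U ∈ M, ∃ W ∈ M', IsLAdjoint U W) {U : P →ₗ[ℂ] Q} (hU : U ∈ Submodule.span ℂ M) :
    ∃ W ∈ Submodule.span ℂ M', IsLAdjoint U W := by
  induction hU using Submodule.span_induction with
  | mem U hU =>
    obtain ⟨W, hW, hUW⟩ := h U hU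
    exact ⟨W, Submodule.subset_span hW, hUW⟩
  | zero => exact ⟨0, Submodule.zero_mem _, fun x y => by simp⟩
  | add U V _ _ hU hV =>
    obtain ⟨W, hW, hUW⟩ := hU
    obtain ⟨X, hX, hVX⟩ := hV
    refine ⟨W + X, Submodule.add_mem _ hW hX, fun x y => ?_⟩
    rw [LinearMap.add_apply, LinearMap.add_apply, inner_add_left, inner_add_right, hUW, hVX]
  | smul c U _ hU =>
    obtain ⟨W, hW, hUW⟩ := hU
    refine ⟨(starRingEnd ℂ) c • W, Submodule.smul_mem _ _ hW, fun x y => ?_⟩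
    rw [LinearMap.smul_apply, LinearMap.smul_apply, inner_smul_left, inner_smul_right, hUW]

theorem adjoint_mem_locClosedSpan {M : Set (P →ₗ[ℂ] Q)} {M' : Set (Q →ₗ[ℂ] P)}
    (hM : M ⊆ locallyBounded hP hQ) (hM' : M' ⊆ locallyBounded hQ hP)
    (h : ∀ U ∈ M, ∀ W, IsLAdjoint U W → W ∈ M') {T : P →ₗ[ℂ] Q} {S : Q →ₗ[ℂ] P}
    (hT : T ∈ locClosedSpan hP hQ M) (hTS : IsLAdjoint T S) : S ∈ locClosedSpan hQ hP M' := by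
  rw [mem_locClosedSpan_iff hM] at hT
  rw [mem_locClosedSpan_iff hM']
  refine ⟨hT.1.adjoint hTS, fun γ ε hε => ?_⟩
  obtain ⟨V, hV, hTV⟩ := hT.2 γ ε hε
  obtain ⟨W, hW, hVW⟩ := exists_isLAdjoint_mem_span (M' := M') (fun U hU => by
    obtain ⟨W, hW⟩ := IsLocallyBounded.exists_isLAdjoint (hM hU)
    exact ⟨W, h U hU W hW, hW⟩) hV
  have hadj : IsLAdjoint (T - V) (S - W) := fun x y => by
    rw [LinearMap.sub_apply, LinearMap.sub_apply, inner_sub_left, inner_sub_right, hTS, hVW]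
  exact ⟨W, hW, IsLocallyBounded.adjoint_bound (hQ := hQ)
    ((locallyBounded hP hQ).sub_mem hT.1 (Submodule.span_le.2 hM hV)) hadj hε.le hTV⟩

end LocallyBoundedOperators

section TensorOperators

variable {Λ : Type*} [PartialOrder Λ] {A' : Type*} [PartialOrder A']
  {H : Type*} [NormedAddCommGroup H] [InnerProductSpace ℂ H]
  {K : Type*} [NormedAddCommGroup K] [InnerProductSpace ℂ K]
  {G : Type*} [NormedAddCommGroup G] [InnerProductSpace ℂ G]
  {N : Type*} [NormedAddCommGroup N] [InnerProductSpace ℂ N]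
  {P : Type*} [NormedAddCommGroup P] [InnerProductSpace ℂ P]
  {Q : Type*} [NormedAddCommGroup Q] [InnerProductSpace ℂ Q]
  {hH : LocallyHilbert Λ H} {hK : LocallyHilbert Λ K}
  {hG : LocallyHilbert A' G} {hN : LocallyHilbert A' N}
  {hP : LocallyHilbert (Λ × A') P} {t : H →ₗ[ℂ] G →ₗ[ℂ] P}
  {hQ : LocallyHilbert (Λ × A') Q} {t' : K →ₗ[ℂ] N →ₗ[ℂ] Q}

theorem IsLocTensor.ext_inner (ht : IsLocTensor hH hG hP t) {x y : P}
    (h : ∀ (u : H) (v : G), ⟪t u v, x⟫_ℂ = ⟪t u v, y⟫_ℂ) : x = y := by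
  obtain ⟨⟨l, α⟩, hmem⟩ := hP.exhaustive (x - y)
  rw [← ht.dense_span] at hmem
  have hle : Submodule.span ℂ {u : P | ∃ h ∈ hH.E l, ∃ g ∈ hG.E α, t h g = u} ≤
      (ℂ ∙ (x - y))ᗮ := by
    rw [Submodule.span_le]
    rintro _ ⟨u, -, v, -, rfl⟩
    rw [SetLike.mem_coe, Submodule.mem_orthogonal_singleton_iff_inner_left, inner_sub_right,
      h, sub_self]
  have hmem' := Submodule.topologicalClosure_minimal _ hle
    (Submodule.isClosed_orthogonal _) hmem
  rw [Submodule.mem_orthogonal_singleton_iff_inner_left, inner_self_eq_zero] at hmem'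
  exact sub_eq_zero.1 hmem'

theorem IsTensorOp.adjoint (ht : IsLocTensor hH hG hP t) (ht' : IsLocTensor hK hN hQ t')
    {T : H →ₗ[ℂ] K} {S : G →ₗ[ℂ] N} {U : P →ₗ[ℂ] Q} (hU : IsTensorOp t t' T S U)
    {Tstar : K →ₗ[ℂ] H} {Sstar : N →ₗ[ℂ] G} {Ustar : Q →ₗ[ℂ] P} (hT : IsLAdjoint T Tstar)
    (hS : IsLAdjoint S Sstar) (hUstar : IsLAdjoint U Ustar) :
    IsTensorOp t' t Tstar Sstar Ustar := fun k n => ht.ext_inner fun h g => by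
  rw [← hUstar, hU, ht'.inner_eq, ht.inner_eq, hT, hS]

theorem IsTensorOp.comp {H₁ G₁ P₁ H₂ G₂ P₂ H₃ G₃ P₃ : Type*}
    [AddCommGroup H₁] [Module ℂ H₁] [AddCommGroup G₁] [Module ℂ G₁]
    [AddCommGroup P₁] [Module ℂ P₁] [AddCommGroup H₂] [Module ℂ H₂]
    [AddCommGroup G₂] [Module ℂ G₂] [AddCommGroup P₂] [Module ℂ P₂]
    [AddCommGroup H₃] [Module ℂ H₃] [AddCommGroup G₃] [Module ℂ G₃]
    [AddCommGroup P₃] [Module ℂ P₃]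
    {t₁ : H₁ →ₗ[ℂ] G₁ →ₗ[ℂ] P₁} {t₂ : H₂ →ₗ[ℂ] G₂ →ₗ[ℂ] P₂} {t₃ : H₃ →ₗ[ℂ] G₃ →ₗ[ℂ] P₃}
    {T : H₁ →ₗ[ℂ] H₂} {S : G₁ →ₗ[ℂ] G₂} {U : P₁ →ₗ[ℂ] P₂}
    {T' : H₂ →ₗ[ℂ] H₃} {S' : G₂ →ₗ[ℂ] G₃} {U' : P₂ →ₗ[ℂ] P₃}
    (hU' : IsTensorOp t₂ t₃ T' S' U') (hU : IsTensorOp t₁ t₂ T S U) :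
    IsTensorOp t₁ t₃ (T' ∘ₗ T) (S' ∘ₗ S) (U' ∘ₗ U) := fun h g => by
  simp only [LinearMap.comp_apply, hU h g, hU' (T h) (S g)]

end TensorOperators

/-- Exterior tensor product of concrete Hilbert locally C*-modules
`(E, A)` (over `H, K`) and `(F, B)` (over `G, N`): with `C` the closed span of
`{a ⊗ b}` in `B_loc(H ⊗_loc G)` and `Ê` the closed span of `{T ⊗ S}` in
`B_loc(H ⊗_loc G, K ⊗_loc N)`, (i) `(T₁ ⊗ S₁)* ∘ (T₂ ⊗ S₂) = (T₁* T₂) ⊗ (S₁* S₂)`,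
and `(Ê, C)` is a concrete Hilbert locally C*-module — in particular (ii) `C` is a
`*`-subalgebra of `B_loc(H ⊗_loc G)` and (iii) `Ê ∘ C ⊆ Ê` with `T* ∘ S ∈ C` for
`T, S ∈ Ê`. -/
theorem exterior_tensor_product_concrete
    {Λ : Type v₁} [PartialOrder Λ] [Nonempty Λ] [IsDirected Λ (· ≤ ·)]
    {A' : Type v₂} [PartialOrder A'] [Nonempty A'] [IsDirected A' (· ≤ ·)]
    {H : Type u₁} [NormedAddCommGroup H] [InnerProductSpace ℂ H]
    {K : Type u₂} [NormedAddCommGroup K] [InnerProductSpace ℂ K]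
    {G : Type u₃} [NormedAddCommGroup G] [InnerProductSpace ℂ G]
    {N : Type u₄} [NormedAddCommGroup N] [InnerProductSpace ℂ N]
    {P : Type u₅} [NormedAddCommGroup P] [InnerProductSpace ℂ P]
    {Q : Type u₆} [NormedAddCommGroup Q] [InnerProductSpace ℂ Q]
    (hH : LocallyHilbert Λ H) (hK : LocallyHilbert Λ K)
    (hG : LocallyHilbert A' G) (hN : LocallyHilbert A' N)
    (hP : LocallyHilbert (Λ × A') P) (t : H →ₗ[ℂ] G →ₗ[ℂ] P)
    (ht : IsLocTensor hH hG hP t)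
    (hQ : LocallyHilbert (Λ × A') Q) (t' : K →ₗ[ℂ] N →ₗ[ℂ] Q)
    (ht' : IsLocTensor hK hN hQ t')
    (Aset : Set (H →ₗ[ℂ] H)) (Eset : Set (H →ₗ[ℂ] K))
    (hEA : IsConcreteModule hH hK Aset Eset)
    (Bset : Set (G →ₗ[ℂ] G)) (Fset : Set (G →ₗ[ℂ] N))
    (hFB : IsConcreteModule hG hN Bset Fset) :
    -- (i)
    (∀ T₁ ∈ Eset, ∀ T₂ ∈ Eset, ∀ S₁ ∈ Fset, ∀ S₂ ∈ Fset,
      ∀ U₁ U₂ : P →ₗ[ℂ] Q,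
        IsLocallyBounded hP hQ U₁ → IsTensorOp t t' T₁ S₁ U₁ →
        IsLocallyBounded hP hQ U₂ → IsTensorOp t t' T₂ S₂ U₂ →
        ∀ U₁star : Q →ₗ[ℂ] P, IsLAdjoint U₁ U₁star →
        ∀ T₁star : K →ₗ[ℂ] H, IsLAdjoint T₁ T₁star →
        ∀ S₁star : N →ₗ[ℂ] G, IsLAdjoint S₁ S₁star →
          IsTensorOp t t (T₁star ∘ₗ T₂) (S₁star ∘ₗ S₂) (U₁star ∘ₗ U₂)) ∧
    -- (ii) & (iii): `(Ê, C)` is a concrete Hilbert locally C*-module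
    IsConcreteModule hP hQ
      (locClosedSpan hP hP
        {U : P →ₗ[ℂ] P | IsLocallyBounded hP hP U ∧
          ∃ a ∈ Aset, ∃ b ∈ Bset, IsTensorOp t t a b U})
      (locClosedSpan hP hQ
        {U : P →ₗ[ℂ] Q | IsLocallyBounded hP hQ U ∧
          ∃ T ∈ Eset, ∃ S ∈ Fset, IsTensorOp t t' T S U}) := by
  set MC : Set (P →ₗ[ℂ] P) := {U | IsLocallyBounded hP hP U ∧
    ∃ a ∈ Aset, ∃ b ∈ Bset, IsTensorOp t t a b U}
  set ME : Set (P →ₗ[ℂ] Q) := {U | IsLocallyBounded hP hQ U ∧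
    ∃ T ∈ Eset, ∃ S ∈ Fset, IsTensorOp t t' T S U}
  let MEstar : Set (Q →ₗ[ℂ] P) := {W | ∃ U ∈ ME, IsLAdjoint U W}
  have hMC : MC ⊆ locallyBounded hP hP := fun U hU => hU.1
  have hME : ME ⊆ locallyBounded hP hQ := fun U hU => hU.1
  have hMEstar : MEstar ⊆ locallyBounded hQ hP := fun W ⟨U, hU, hUW⟩ => hU.1.adjoint hUW
  have hmul : ∀ U ∈ MC, ∀ V ∈ MC, U ∘ₗ V ∈ MC := by
    rintro U ⟨hU, a, ha, b, hb, hab⟩ V ⟨hV, c, hc, d, hd, hcd⟩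
    exact ⟨hU.comp hV, a ∘ₗ c, hEA.alg_mul a ha c hc, b ∘ₗ d, hFB.alg_mul b hb d hd,
      hab.comp hcd⟩
  have hstar : ∀ U ∈ MC, ∀ W, IsLAdjoint U W → W ∈ MC := by
    rintro U ⟨hU, a, ha, b, hb, hab⟩ W hW
    obtain ⟨c, hc⟩ := (hEA.alg_lb a ha).exists_isLAdjoint
    obtain ⟨d, hd⟩ := (hFB.alg_lb b hb).exists_isLAdjoint
    exact ⟨hU.adjoint hW, c, hEA.alg_star a ha c hc, d, hFB.alg_star b hb d hd,
      hab.adjoint ht ht hc hd hW⟩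
  have hsmulA : ∀ U ∈ ME, ∀ V ∈ MC, U ∘ₗ V ∈ ME := by
    rintro U ⟨hU, T, hT, S, hS, hTS⟩ V ⟨hV, a, ha, b, hb, hab⟩
    exact ⟨hU.comp hV, T ∘ₗ a, hEA.mod_smulA T hT a ha, S ∘ₗ b, hFB.mod_smulA S hS b hb,
      hTS.comp hab⟩
  have hgram : ∀ W ∈ MEstar, ∀ V ∈ ME, W ∘ₗ V ∈ MC := by
    rintro W ⟨U, ⟨hU, T₁, hT₁, S₁, hS₁, hU₁⟩, hUW⟩ V ⟨hV, T₂, hT₂, S₂, hS₂, hV₂⟩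
    obtain ⟨c, hc⟩ := (hEA.mod_lb T₁ hT₁).exists_isLAdjoint
    obtain ⟨d, hd⟩ := (hFB.mod_lb S₁ hS₁).exists_isLAdjoint
    exact ⟨(hU.adjoint hUW).comp hV, c ∘ₗ T₂, hEA.mod_gram T₁ hT₁ T₂ hT₂ c hc,
      d ∘ₗ S₂, hFB.mod_gram S₁ hS₁ S₂ hS₂ d hd, (hU₁.adjoint ht ht' hc hd hUW).comp hV₂⟩
  refine ⟨fun T₁ _ T₂ _ S₁ _ S₂ _ U₁ U₂ _ hU₁ _ hU₂ U₁star hU T₁star hT S₁star hS =>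
    (hU₁.adjoint ht ht' hT hS hU).comp hU₂, ?_⟩
  exact
    { alg_lb := fun _ hU => hU.1
      alg_add := fun _ hU _ hV => add_mem_locClosedSpan hMC hU hV
      alg_smul := fun c _ hU => smul_mem_locClosedSpan hMC c hU
      alg_mul := fun _ hU _ hV => comp_mem_locClosedSpan hMC hMC hMC hmul hU hV
      alg_star := fun _ hU _ hUW => adjoint_mem_locClosedSpan hMC hMC hstar hU hUW
      alg_closed := fun _ hT h => mem_locClosedSpan_of_forall_exists hMC hT h
      mod_lb := fun _ hU => hU.1
      mod_add := fun _ hU _ hV => add_mem_locClosedSpan hME hU hV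
      mod_smul := fun c _ hU => smul_mem_locClosedSpan hME c hU
      mod_closed := fun _ hT h => mem_locClosedSpan_of_forall_exists hME hT h
      mod_smulA := fun _ hU _ hV => comp_mem_locClosedSpan hME hMC hME hsmulA hU hV
      mod_gram := fun _ hU _ hV _ hUW => comp_mem_locClosedSpan hMEstar hME hMC hgram
        (adjoint_mem_locClosedSpan hME hMEstar (fun U hU W hW => ⟨U, hU, hW⟩) hU hUW) hV }
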